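/- There is an absolute constant c > 0 such that the following holds for all t, n with n ≤ t/100 and all p ∈ (0, 1/2]. Let M be a k-pass streaming algorithm on streams in [t]^n whose memory does not change during its k-th pass (M_{(k,j)} = M_{(k-1,n)} for all j ∈ [n]), together with an output bit that is a (possibly randomized) function of the final memory state M_{(k,n)}. If Pr[output = 1 when X ∼ D0] + Pr[output = 0 when X ∼ D1] ≤ 0.01, then MIC(M, D0) ≥ c/p². -/

import Mathlib

open scoped Classical
open Finset

noncomputable section

namespace MultiPassIC

/-- Probability of an event under a probability mass function `p` on a finite sample space. -/
def pr {Ω : Type} [Fintype Ω] (p : Ω → ℝ) (E : Ω → Prop) : ℝ :=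
  ∑ ω, if E ω then p ω else 0

/-- `p` is a probability mass function on the finite type `Ω`. -/
structure IsPMF {Ω : Type} [Fintype Ω] (p : Ω → ℝ) : Prop where
  nonneg : ∀ ω, 0 ≤ p ω
  sum_one : ∑ ω, p ω = 1

/-- Shannon entropy (base 2) of the random variable `A` under `p`. -/
def H {Ω : Type} [Fintype Ω] {α : Type} [Fintype α] (p : Ω → ℝ) (A : Ω → α) : ℝ :=
  -∑ a, pr p (fun ω => A ω = a) * Real.logb 2 (pr p (fun ω => A ω = a))

/-- Conditional mutual information `I(A ; B ∣ C)` (base 2), with the usual conventions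
for vanishing probabilities. -/
def condMI {Ω : Type} [Fintype Ω] {α β γ : Type} [Fintype α] [Fintype β] [Fintype γ]
    (p : Ω → ℝ) (A : Ω → α) (B : Ω → β) (C : Ω → γ) : ℝ :=
  ∑ a, ∑ b, ∑ c,
    pr p (fun ω => A ω = a ∧ B ω = b ∧ C ω = c) *
      Real.logb 2 ((pr p (fun ω => C ω = c) *
          pr p (fun ω => A ω = a ∧ B ω = b ∧ C ω = c)) /
        (pr p (fun ω => A ω = a ∧ C ω = c) * pr p (fun ω => B ω = b ∧ C ω = c)))

/-- Mutual information `I(A ; B)` (base 2). -/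
def MI {Ω : Type} [Fintype Ω] {α β : Type} [Fintype α] [Fintype β]
    (p : Ω → ℝ) (A : Ω → α) (B : Ω → β) : ℝ :=
  condMI p A B (fun _ => (0 : Fin 1))

/-- `X 0, …, X (n-1)` (the first `n` stream elements) are mutually independent under `p`,
i.e. they are drawn from a product distribution. -/
def IsProduct {Ω : Type} [Fintype Ω] {𝒳 : Type} (p : Ω → ℝ) (n : ℕ) (X : ℕ → Ω → 𝒳) : Prop :=
  ∀ x : ℕ → 𝒳,
    pr p (fun ω => ∀ j < n, X j ω = x j) =
      ∏ j ∈ Finset.range n, pr p (fun ω => X j ω = x j)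

/-- A `k`-pass streaming algorithm on the input stream `X 0, …, X (n-1)` (0-indexed;
the paper's `X_j` is `X (j-1)`), over a finite sample space `Ω` with pmf `p`.
`S` is the finite set of memory states, `Rv` the value space of the per-step private
randomness, `init` the initial memory state `M₀`, `R i j` the private randomness used at
step `j` of pass `i` (0-indexed), and `f i j` the corresponding transition function.
The field `indep` states that the initial state, all the per-step random seeds, and the
input stream are mutually independent. -/
structure Alg (Ω : Type) [Fintype Ω] (p : Ω → ℝ) (𝒳 : Type) [Fintype 𝒳]
    (n k : ℕ) (X : ℕ → Ω → 𝒳) where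
  S : Type
  fintS : Fintype S
  Rv : Type
  fintR : Fintype Rv
  init : Ω → S
  R : ℕ → ℕ → Ω → Rv
  f : ℕ → ℕ → 𝒳 → S → Rv → S
  indep : ∀ (m : S) (r : ℕ → ℕ → Rv) (x : ℕ → 𝒳),
    pr p (fun ω => init ω = m ∧ (∀ i < k, ∀ j < n, R i j ω = r i j) ∧ (∀ j < n, X j ω = x j))
      = pr p (fun ω => init ω = m)
        * (∏ i ∈ Finset.range k, ∏ j ∈ Finset.range n, pr p (fun ω => R i j ω = r i j))
        * pr p (fun ω => ∀ j < n, X j ω = x j)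

attribute [instance] Alg.fintS Alg.fintR

variable {Ω : Type} [Fintype Ω] {p : Ω → ℝ} {𝒳 : Type} [Fintype 𝒳] {n k : ℕ} {X : ℕ → Ω → 𝒳}

/-- Running pass `i` (0-indexed) of the algorithm for `j` steps starting from `ini`. -/
def Alg.runPass (M : Alg Ω p 𝒳 n k X) (i : ℕ) (ini : Ω → M.S) : ℕ → Ω → M.S
  | 0 => ini
  | j + 1 => fun ω =>
      if j < n ∧ i < k then
        M.f i j (X j ω) (M.runPass i ini j ω) (M.R i j ω)
      else M.runPass i ini j ω

/-- `M.passEnd i` is the memory state at the end of pass `i`; `M.passEnd 0 = M₀` is the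
initial state, and `M.passEnd i` is the paper's `M_i = M_{(i,n)}`. -/
def Alg.passEnd (M : Alg Ω p 𝒳 n k X) : ℕ → Ω → M.S
  | 0 => M.init
  | i + 1 => M.runPass i (M.passEnd i) n

/-- `M.st i j` is the memory state after reading `j` elements in pass `i+1`;
it is the paper's `M_{(i+1, j)}`. -/
def Alg.st (M : Alg Ω p 𝒳 n k X) (i j : ℕ) : Ω → M.S :=
  M.runPass i (M.passEnd i) j

/-- The multi-pass information cost
`MIC(M, μ) = Σ_{i=1}^{k} Σ_{j=1}^{n} Σ_{ℓ=1}^{j} I(M_{(i,j)}; X_ℓ | M_{(≤i,ℓ-1)}, M_{(≤i-1,j)})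
  + Σ_{i=1}^{k} Σ_{j=1}^{n} Σ_{ℓ=j+1}^{n} I(M_{(i,j)}; X_ℓ | M_{(≤i-1,ℓ-1)}, M_{(≤i-1,j)})`
(all summation indices below are 0-indexed shifts of the paper's 1-indexed ones). -/
def Alg.MIC (M : Alg Ω p 𝒳 n k X) : ℝ :=
  (∑ i ∈ Finset.range k, ∑ j ∈ Finset.range n, ∑ l ∈ Finset.range (j + 1),
    condMI p (M.st i (j + 1)) (X l)
      (fun ω => ((fun r : Fin (i + 1) => M.st r.1 l ω),
                 (fun r : Fin i => M.st r.1 (j + 1) ω))))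
  + (∑ i ∈ Finset.range k, ∑ j ∈ Finset.range n, ∑ l ∈ Finset.Ico (j + 1) n,
    condMI p (M.st i (j + 1)) (X l)
      (fun ω => ((fun r : Fin i => M.st r.1 l ω),
                 (fun r : Fin i => M.st r.1 (j + 1) ω))))

/-- The conditional information cost
`MIC_cond(M, μ) = Σ_{j=1}^{n} Σ_{ℓ=1}^{j} I(M_{(≤k,j)}; X_ℓ | M_{<k}, M_{(≤k,ℓ-1)})`. -/
def Alg.MICcond (M : Alg Ω p 𝒳 n k X) : ℝ :=
  ∑ j ∈ Finset.range n, ∑ l ∈ Finset.range (j + 1),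
    condMI p (fun ω => fun r : Fin k => M.st r.1 (j + 1) ω) (X l)
      (fun ω => ((fun r : Fin k => M.passEnd r.1 ω),
                 (fun r : Fin k => M.st r.1 l ω)))

end MultiPassIC

namespace MultiPassIC

/-- The needle distribution `D1` with needle probability `q` as a probability mass
function on `[t]^n`. -/
def needlePMF (t n : ℕ) (q : ℝ) (x : Fin n → Fin t) : ℝ :=
  ∑ α : Fin t, (1 / (t : ℝ)) *
    ∏ j : Fin n, (if x j = α then q + (1 - q) / t else (1 - q) / t)

section FiniteProbability

variable {Ω : Type} [Fintype Ω] {p : Ω → ℝ} {α β γ : Type}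

/-- The indicator function of an event. -/
def ind {Ω : Type} (E : Ω → Prop) (ω : Ω) : ℝ := if E ω then 1 else 0

/-- The expectation of `f` restricted to the event `E`. -/
def exOn {Ω : Type} [Fintype Ω] (p : Ω → ℝ) (E : Ω → Prop) (f : Ω → ℝ) : ℝ :=
  ∑ ω, if E ω then p ω * f ω else 0

/-- The conditional expectation of `f` given the random variable `C`. -/
def ce {Ω γ : Type} [Fintype Ω] (p : Ω → ℝ) (f : Ω → ℝ) (C : Ω → γ) (ω : Ω) : ℝ :=
  exOn p (fun ω' => C ω' = C ω) f / pr p (fun ω' => C ω' = C ω)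

/-- The expected logarithm of the posterior probability of `B` given `C`, that is, minus the
conditional entropy of `B` given `C`. -/
def logPost {Ω β γ : Type} [Fintype Ω] (p : Ω → ℝ) (B : Ω → β) (C : Ω → γ) : ℝ :=
  ∑ ω, p ω * Real.logb 2 (ce p (ind fun ω' => B ω' = B ω) C ω)

theorem exOn_ind (E D : Ω → Prop) : exOn p E (ind D) = pr p (fun ω => D ω ∧ E ω) := by
  unfold exOn ind pr
  refine Finset.sum_congr rfl fun ω _ => ?_
  by_cases h1 : E ω <;> by_cases h2 : D ω <;> simp [h1, h2]

theorem exOn_one (E : Ω → Prop) : exOn p E (fun _ => 1) = pr p E := by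
  simp [exOn, pr]

theorem pr_nonneg (hp : IsPMF p) (E : Ω → Prop) : 0 ≤ pr p E :=
  Finset.sum_nonneg fun ω _ => by split_ifs <;> simp [hp.nonneg ω]

theorem le_pr (hp : IsPMF p) {E : Ω → Prop} {ω : Ω} (h : E ω) : p ω ≤ pr p E := by
  have := Finset.single_le_sum (f := fun ω => if E ω then p ω else 0)
    (fun ω _ => by split_ifs <;> simp [hp.nonneg ω]) (Finset.mem_univ ω)
  simpa [h, pr] using this

theorem pr_pos (hp : IsPMF p) {E : Ω → Prop} {ω : Ω} (h : E ω) (hω : 0 < p ω) : 0 < pr p E :=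
  hω.trans_le (le_pr hp h)

theorem exOn_nonneg (hp : IsPMF p) (E : Ω → Prop) {f : Ω → ℝ} (hf : ∀ ω, 0 ≤ f ω) :
    0 ≤ exOn p E f :=
  Finset.sum_nonneg fun ω _ => by
    split_ifs
    · exact mul_nonneg (hp.nonneg ω) (hf ω)
    · exact le_rfl

theorem ind_nonneg {Ω : Type} (E : Ω → Prop) (ω : Ω) : 0 ≤ ind E ω := by
  unfold ind; split_ifs <;> norm_num

theorem ce_nonneg (hp : IsPMF p) {f : Ω → ℝ} (hf : ∀ ω, 0 ≤ f ω) (C : Ω → γ) (ω : Ω) :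
    0 ≤ ce p f C ω :=
  div_nonneg (exOn_nonneg hp _ hf) (pr_nonneg hp _)

theorem sum_pr_mul [Fintype α] (A : Ω → α) (h : α → ℝ) :
    ∑ a, pr p (fun ω => A ω = a) * h a = ∑ ω, p ω * h (A ω) := by
  simp only [pr, Finset.sum_mul]
  rw [Finset.sum_comm]
  refine Finset.sum_congr rfl fun ω _ => ?_
  rw [Finset.sum_eq_single (A ω)]
  · simp
  · intro b _ hb
    simp [Ne.symm hb]
  · simp

theorem sum_exOn [Fintype γ] (C : Ω → γ) (f : Ω → ℝ) :
    ∑ c, exOn p (fun ω => C ω = c) f = ∑ ω, p ω * f ω := by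
  simp only [exOn]
  rw [Finset.sum_comm]
  refine Finset.sum_congr rfl fun ω _ => ?_
  rw [Finset.sum_eq_single (C ω)]
  · simp
  · intro b _ hb
    simp [Ne.symm hb]
  · simp

theorem ce_congr {δ : Type} {C : Ω → γ} {C' : Ω → δ}
    (h : ∀ ω ω', C ω = C ω' ↔ C' ω = C' ω') (f : Ω → ℝ) : ce p f C = ce p f C' := by
  funext ω
  simp only [ce, h]

theorem logPost_congr {δ : Type} {C : Ω → γ} {C' : Ω → δ}
    (h : ∀ ω ω', C ω = C ω' ↔ C' ω = C' ω') (B : Ω → β) : logPost p B C = logPost p B C' := by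
  simp only [logPost, ce_congr h]

theorem condMI_eq_sub_logPost (hp : IsPMF p) [Fintype α] [Fintype β] [Fintype γ]
    (A : Ω → α) (B : Ω → β) (C : Ω → γ) :
    condMI p A B C = logPost p B (fun ω => (A ω, C ω)) - logPost p B C := by
  have h1 : condMI p A B C = ∑ ω, p ω * Real.logb 2
      ((pr p (fun ω' => C ω' = C ω) * pr p (fun ω' => A ω' = A ω ∧ B ω' = B ω ∧ C ω' = C ω)) /
        (pr p (fun ω' => A ω' = A ω ∧ C ω' = C ω) * pr p (fun ω' => B ω' = B ω ∧ C ω' = C ω))) := by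
    rw [← sum_pr_mul (fun ω => (A ω, B ω, C ω)) (fun x => Real.logb 2
      ((pr p (fun ω' => C ω' = x.2.2) * pr p (fun ω' => A ω' = x.1 ∧ B ω' = x.2.1 ∧ C ω' = x.2.2)) /
        (pr p (fun ω' => A ω' = x.1 ∧ C ω' = x.2.2) *
          pr p (fun ω' => B ω' = x.2.1 ∧ C ω' = x.2.2))))]
    simp only [Fintype.sum_prod_type, Prod.mk.injEq, condMI]
  rw [h1, logPost, logPost, ← Finset.sum_sub_distrib]
  refine Finset.sum_congr rfl fun ω _ => ?_
  rcases (hp.nonneg ω).eq_or_lt with h0 | h0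
  · simp [← h0]
  · rw [← mul_sub]
    congr 1
    simp only [ce, exOn_ind, Prod.mk.injEq]
    have e1 := pr_pos hp (E := fun ω' => C ω' = C ω) rfl h0
    have e2 := pr_pos hp (E := fun ω' => A ω' = A ω ∧ B ω' = B ω ∧ C ω' = C ω) ⟨rfl, rfl, rfl⟩ h0
    have e3 := pr_pos hp (E := fun ω' => A ω' = A ω ∧ C ω' = C ω) ⟨rfl, rfl⟩ h0
    have e4 := pr_pos hp (E := fun ω' => B ω' = B ω ∧ C ω' = C ω) ⟨rfl, rfl⟩ h0
    have e5 : (fun ω' => B ω' = B ω ∧ A ω' = A ω ∧ C ω' = C ω) =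
        fun ω' => A ω' = A ω ∧ B ω' = B ω ∧ C ω' = C ω := by
      funext ω'; exact propext and_left_comm
    rw [e5, ← Real.logb_div (by positivity) (by positivity)]
    congr 1
    field_simp

/-- Conditional independence of `Φ` and `Ψ` given `C`, in terms of restricted expectations. -/
def CondIndep {Ω γ : Type} [Fintype Ω] (p : Ω → ℝ) (C : Ω → γ) (Φ Ψ : Ω → ℝ) : Prop :=
  ∀ ω₀, exOn p (fun ω => C ω = C ω₀) (fun ω => Φ ω * Ψ ω) * pr p (fun ω => C ω = C ω₀) =
    exOn p (fun ω => C ω = C ω₀) Φ * exOn p (fun ω => C ω = C ω₀) Ψ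

theorem CondIndep.congr {δ : Type} {C : Ω → γ} {C' : Ω → δ}
    (h : ∀ ω ω', C ω = C ω' ↔ C' ω = C' ω') {Φ Ψ : Ω → ℝ} (hC : CondIndep p C Φ Ψ) :
    CondIndep p C' Φ Ψ := by
  simpa only [CondIndep, h] using hC

theorem CondIndep.symm {C : Ω → γ} {Φ Ψ : Ω → ℝ} (h : CondIndep p C Φ Ψ) :
    CondIndep p C Ψ Φ := by
  intro c
  rw [mul_comm (exOn p _ Ψ), ← h c]
  simp only [mul_comm]

theorem exOn_eq_zero (hp : IsPMF p) {E : Ω → Prop} (h : pr p E = 0) (f : Ω → ℝ) :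
    exOn p E f = 0 := by
  refine Finset.sum_eq_zero fun ω _ => ?_
  split_ifs with hE
  · have : p ω = 0 := le_antisymm (h ▸ le_pr hp hE) (hp.nonneg ω)
    simp [this]
  · rfl

theorem CondIndep.sum_ce_mul [Fintype γ] (hp : IsPMF p) {C : Ω → γ} {Φ Ψ : Ω → ℝ}
    (h : CondIndep p C Φ Ψ) :
    ∑ ω, p ω * (ce p Φ C ω * Ψ ω) = ∑ ω, p ω * (Φ ω * Ψ ω) := by
  rw [← sum_exOn C, ← sum_exOn C]
  refine Finset.sum_congr rfl fun c _ => ?_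
  rcases eq_or_ne (pr p (fun ω => C ω = c)) 0 with h0 | h0
  · rw [exOn_eq_zero hp h0, exOn_eq_zero hp h0]
  · obtain ⟨ω₀, rfl⟩ : ∃ ω₀, C ω₀ = c := by
      by_contra hc
      push Not at hc
      simp [pr, hc] at h0
    rw [eq_comm, ← mul_left_inj' h0, h ω₀]
    set c := C ω₀
    have : exOn p (fun ω => C ω = c) (fun ω => ce p Φ C ω * Ψ ω) =
        exOn p (fun ω => C ω = c) Φ / pr p (fun ω => C ω = c) * exOn p (fun ω => C ω = c) Ψ := by
      conv_rhs => rw [exOn.eq_def _ _ Ψ, Finset.mul_sum]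
      refine Finset.sum_congr rfl fun ω _ => ?_
      by_cases hc : C ω = c
      · simp only [hc, if_true, ce]; ring
      · simp [hc]
    rw [this]
    field_simp

theorem CondIndep.of_measurable (C : Ω → γ) (Φ : Ω → ℝ) {Ψ : Ω → ℝ}
    (h : ∀ ω ω', C ω = C ω' → Ψ ω = Ψ ω') : CondIndep p C Φ Ψ := by
  intro ω₀
  have key : ∀ f : Ω → ℝ, exOn p (fun ω => C ω = C ω₀) (fun ω => f ω * Ψ ω) =
      exOn p (fun ω => C ω = C ω₀) f * Ψ ω₀ := by
    intro f
    simp only [exOn, Finset.sum_mul]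
    refine Finset.sum_congr rfl fun ω _ => ?_
    by_cases hc : C ω = C ω₀
    · simp only [hc, if_true, h _ _ hc]; ring
    · simp [hc]
  have := key fun _ => 1
  simp only [one_mul, exOn_one] at this
  rw [key, this]
  ring

theorem CondIndep.logPost_pair (hp : IsPMF p) {B : Ω → β} {Z : Ω → α} {C : Ω → γ}
    (h : ∀ b z, CondIndep p C (ind fun ω => B ω = b) (ind fun ω => Z ω = z)) :
    logPost p B (fun ω => (Z ω, C ω)) = logPost p B C := by
  refine Finset.sum_congr rfl fun ω₀ _ => ?_
  rcases (hp.nonneg ω₀).eq_or_lt with h0 | h0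
  · simp [← h0]
  congr 2
  have key := h (B ω₀) (Z ω₀) ω₀
  have e : (fun ω' => ind (fun ω => B ω = B ω₀) ω' * ind (fun ω => Z ω = Z ω₀) ω') =
      ind fun ω' => B ω' = B ω₀ ∧ Z ω' = Z ω₀ := by
    funext ω'
    by_cases h1 : B ω' = B ω₀ <;> by_cases h2 : Z ω' = Z ω₀ <;> simp [ind, h1, h2]
  rw [e] at key
  simp only [exOn_ind, and_assoc] at key
  simp only [ce, exOn_ind, Prod.mk.injEq]
  have e1 := pr_pos hp (E := fun ω' => C ω' = C ω₀) rfl h0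
  have e3 := pr_pos hp (E := fun ω' => Z ω' = Z ω₀ ∧ C ω' = C ω₀) ⟨rfl, rfl⟩ h0
  rw [div_eq_div_iff e3.ne' e1.ne', key]

theorem condIndep_of_rect {𝓘 𝓞 : Type} [Fintype 𝓘] [Fintype 𝓞] {I : Ω → 𝓘} {O : Ω → 𝓞}
    {C : Ω → γ} {F : 𝓘 → ℝ} {G : 𝓞 → ℝ}
    (hFG : ∀ u v, pr p (fun ω => I ω = u ∧ O ω = v) = F u * G v)
    (hrect : ∀ ω ω' ω'', I ω'' = I ω → O ω'' = O ω' → C ω = C ω' → C ω'' = C ω)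
    {Φ Ψ : Ω → ℝ} (hΦ : ∀ ω ω', I ω = I ω' → C ω = C ω' → Φ ω = Φ ω')
    (hΨ : ∀ ω ω', O ω = O ω' → C ω = C ω' → Ψ ω = Ψ ω') : CondIndep p C Φ Ψ := by
  intro ω₀
  set c := C ω₀
  let a (f : Ω → ℝ) (u : 𝓘) : ℝ := if h : ∃ ω, I ω = u ∧ C ω = c then f h.choose else 0
  let b (f : Ω → ℝ) (v : 𝓞) : ℝ := if h : ∃ ω, O ω = v ∧ C ω = c then f h.choose else 0
  have main : ∀ f g : Ω → ℝ, (∀ ω ω', I ω = I ω' → C ω = C ω' → f ω = f ω') →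
      (∀ ω ω', O ω = O ω' → C ω = C ω' → g ω = g ω') →
      exOn p (fun ω => C ω = c) (fun ω => f ω * g ω) =
        (∑ u, F u * a f u) * ∑ v, G v * b g v := by
    intro f g hf hg
    have e1 : exOn p (fun ω => C ω = c) (fun ω => f ω * g ω) =
        ∑ ω, p ω * (a f (I ω) * b g (O ω)) := by
      refine Finset.sum_congr rfl fun ω _ => ?_
      by_cases hc : C ω = c
      · have h1 : ∃ ω', I ω' = I ω ∧ C ω' = c := ⟨ω, rfl, hc⟩
        have h2 : ∃ ω', O ω' = O ω ∧ C ω' = c := ⟨ω, rfl, hc⟩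
        simp only [hc, if_true, a, b, dif_pos h1, dif_pos h2]
        rw [hf _ ω h1.choose_spec.1 (h1.choose_spec.2.trans hc.symm),
          hg _ ω h2.choose_spec.1 (h2.choose_spec.2.trans hc.symm)]
      · have : a f (I ω) * b g (O ω) = 0 := by
          by_contra hne
          have h1 : ∃ ω', I ω' = I ω ∧ C ω' = c := by
            by_contra h1; simp [a, h1] at hne
          have h2 : ∃ ω', O ω' = O ω ∧ C ω' = c := by
            by_contra h2; simp [b, h2] at hne
          obtain ⟨ω₁, h11, h12⟩ := h1
          obtain ⟨ω₂, h21, h22⟩ := h2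
          exact hc ((hrect ω₁ ω₂ ω h11.symm h21.symm (h12.trans h22.symm)).trans h12)
        simp [hc, this]
    rw [e1, ← sum_pr_mul (fun ω => (I ω, O ω)) (fun x => a f x.1 * b g x.2),
      Fintype.sum_prod_type, Finset.sum_mul_sum]
    refine Finset.sum_congr rfl fun u _ => Finset.sum_congr rfl fun v _ => ?_
    simp only [Prod.mk.injEq, hFG]
    ring
  have h11 := main (fun _ => 1) (fun _ => 1) (fun _ _ _ _ => rfl) fun _ _ _ _ => rfl
  have h12 := main (fun _ => 1) Ψ (fun _ _ _ _ => rfl) hΨ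
  have h21 := main Φ (fun _ => 1) hΦ fun _ _ _ _ => rfl
  simp only [one_mul, mul_one, exOn_one] at h11 h12 h21
  rw [main Φ Ψ hΦ hΨ, h11, h12, h21]
  ring

theorem sum_ce_ind [Fintype β] (hp : IsPMF p) (B : Ω → β) (C : Ω → γ) {ω : Ω} (hω : 0 < p ω) :
    ∑ b, ce p (ind fun ω' => B ω' = b) C ω = 1 := by
  have e1 := pr_pos hp (E := fun ω' => C ω' = C ω) rfl hω
  simp only [ce]
  rw [← Finset.sum_div, div_eq_one_iff_eq e1.ne']
  simp only [exOn]
  rw [Finset.sum_comm]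
  refine Finset.sum_congr rfl fun ω' _ => ?_
  by_cases h : C ω' = C ω
  · simp [h, ind]
  · simp [h]

end FiniteProbability

section Streaming

variable {Ω : Type} [Fintype Ω] {p : Ω → ℝ} {𝒳 : Type} [Fintype 𝒳] {n k : ℕ} {X : ℕ → Ω → 𝒳}

/-- `ω` and `ω'` have the same stream elements and random seeds at all positions in `P`. -/
def Alg.AgreeOn (M : Alg Ω p 𝒳 n k X) (P : ℕ → Prop) (ω ω' : Ω) : Prop :=
  ∀ j < n, P j → X j ω = X j ω' ∧ ∀ i < k, M.R i j ω = M.R i j ω'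

/-- `ω` and `ω'` agree on the block of positions `[c, d)`. -/
def Alg.AgreeIn (M : Alg Ω p 𝒳 n k X) (c d : ℕ) (ω ω' : Ω) : Prop :=
  M.AgreeOn (fun j => c ≤ j ∧ j < d) ω ω'

/-- `ω` and `ω'` agree on the initial state and on all positions outside of `[c, d)`. -/
def Alg.AgreeOut (M : Alg Ω p 𝒳 n k X) (c d : ℕ) (ω ω' : Ω) : Prop :=
  M.init ω = M.init ω' ∧ M.AgreeOn (fun j => ¬(c ≤ j ∧ j < d)) ω ω'

theorem Alg.condIndep (M : Alg Ω p 𝒳 n k X) (hp : IsPMF p) {κ : ℝ}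
    (hX : ∀ x : Fin n → 𝒳, pr p (fun ω => ∀ j : Fin n, X j.1 ω = x j) = κ)
    (c d : ℕ) {γ : Type} {C : Ω → γ}
    (hrect : ∀ ω ω' ω'', M.AgreeIn c d ω'' ω → M.AgreeOut c d ω'' ω' → C ω = C ω' → C ω'' = C ω)
    {Φ Ψ : Ω → ℝ} (hΦ : ∀ ω ω', M.AgreeIn c d ω ω' → C ω = C ω' → Φ ω = Φ ω')
    (hΨ : ∀ ω ω', M.AgreeOut c d ω ω' → C ω = C ω' → Ψ ω = Ψ ω') : CondIndep p C Φ Ψ := by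
  obtain ⟨ω₀⟩ : Nonempty Ω := by
    by_contra h
    rw [not_nonempty_iff] at h
    simpa using hp.sum_one
  let P : Fin n → Prop := fun j => c ≤ j.1 ∧ j.1 < d
  let V (j : Fin n) (ω : Ω) : 𝒳 × (Fin k → M.Rv) := (X j ω, fun i => M.R i j ω)
  let g (j : Fin n) (y : 𝒳 × (Fin k → M.Rv)) : ℝ := ∏ i : Fin k, pr p (fun ω => M.R i j ω = y.2 i)
  have hV : ∀ j ω ω', V j ω = V j ω' ↔ X j ω = X j ω' ∧ ∀ i < k, M.R i j ω = M.R i j ω' := by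
    intro j ω ω'
    simp only [V, Prod.mk.injEq, funext_iff]
    exact and_congr_right fun _ => ⟨fun h i hi => h ⟨i, hi⟩, fun h i => h i i.2⟩
  refine condIndep_of_rect (I := fun ω => fun j : {j // P j} => V j ω)
    (O := fun ω => (M.init ω, fun j : {j // ¬P j} => V j ω))
    (F := fun u => ∏ j : {j // P j}, g j (u j))
    (G := fun v => pr p (fun ω => M.init ω = v.1) * κ * ∏ j : {j // ¬P j}, g j (v.2 j))
    ?_ ?_ ?_ ?_
  · rintro u ⟨m, v⟩
    let w (j : Fin n) : 𝒳 × (Fin k → M.Rv) := if h : P j then u ⟨j, h⟩ else v ⟨j, h⟩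
    have hw1 : ∀ j : {j // P j}, w j = u j := fun j => by simp only [w, dif_pos j.2]
    have hw2 : ∀ j : {j // ¬P j}, w j = v j := fun j => by simp only [w, dif_neg j.2]
    let x (j : ℕ) : 𝒳 := if h : j < n then (w ⟨j, h⟩).1 else X j ω₀
    let r (i j : ℕ) : M.Rv := if h : i < k ∧ j < n then (w ⟨j, h.2⟩).2 ⟨i, h.1⟩ else M.R i j ω₀
    have hx : ∀ j : Fin n, x j = (w j).1 := fun j => by simp [x]
    have hr : ∀ (i : Fin k) (j : Fin n), r i j = (w j).2 i := fun i j => by simp [r]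
    have e := M.indep m r x
    have e1 : (fun ω => (fun j : {j // P j} => V j ω) = u ∧
        (M.init ω, fun j : {j // ¬P j} => V j ω) = (m, v)) =
        fun ω => M.init ω = m ∧ (∀ i < k, ∀ j < n, M.R i j ω = r i j) ∧ ∀ j < n, X j ω = x j := by
      funext ω
      have hall : ((∀ i < k, ∀ j < n, M.R i j ω = r i j) ∧ ∀ j < n, X j ω = x j) ↔
          ∀ j : Fin n, V j ω = w j := by
        constructor
        · rintro ⟨h1, h2⟩ j
          refine Prod.ext ?_ (funext fun i => ?_)
          · rw [← hx]; exact h2 j j.2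
          · rw [← hr]; exact h1 i i.2 j j.2
        · intro h
          refine ⟨fun i hi j hj => ?_, fun j hj => ?_⟩
          · have := hr ⟨i, hi⟩ ⟨j, hj⟩
            dsimp only at this
            rw [this, ← h]
          · have := hx ⟨j, hj⟩
            dsimp only at this
            rw [this, ← h]
      rw [hall]
      simp only [Prod.mk.injEq, funext_iff, eq_iff_iff]
      constructor
      · rintro ⟨h1, h2, h3⟩
        refine ⟨h2, fun j => ?_⟩
        by_cases hj : P j
        · rw [hw1 ⟨j, hj⟩]; exact h1 ⟨j, hj⟩
        · rw [hw2 ⟨j, hj⟩]; exact h3 ⟨j, hj⟩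
      · rintro ⟨h1, h2⟩
        exact ⟨fun j => (h2 j).trans (hw1 j), h1, fun j => (h2 j).trans (hw2 j)⟩
    rw [e1, e]
    have e2 : pr p (fun ω => ∀ j < n, X j ω = x j) = κ := by
      rw [← hX fun j => x j]
      congr 1
      funext ω
      exact propext ⟨fun h j => h j j.2, fun h j hj => h ⟨j, hj⟩⟩
    have e3 : (∏ i ∈ Finset.range k, ∏ j ∈ Finset.range n, pr p (fun ω => M.R i j ω = r i j)) =
        (∏ j : {j // P j}, g j (u j)) * ∏ j : {j // ¬P j}, g j (v j) := by
      simp only [← hw1, ← hw2]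
      rw [Fintype.prod_subtype_mul_prod_subtype P fun j => g j (w j)]
      simp only [Finset.prod_range, hr, g]
      rw [Finset.prod_comm]
    rw [e2, e3]
    ring
  · intro ω ω' ω'' h1 h2
    simp only [Prod.mk.injEq, funext_iff, hV] at h1 h2
    exact hrect _ _ _ (fun j hj hP => h1 ⟨⟨j, hj⟩, hP⟩)
      ⟨h2.1, fun j hj hP => h2.2 ⟨⟨j, hj⟩, hP⟩⟩
  · intro ω ω' h1
    simp only [funext_iff, hV] at h1
    exact hΦ _ _ fun j hj hP => h1 ⟨⟨j, hj⟩, hP⟩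
  · intro ω ω' h2
    simp only [Prod.mk.injEq, funext_iff, hV] at h2
    exact hΨ _ _ ⟨h2.1, fun j hj hP => h2.2 ⟨⟨j, hj⟩, hP⟩⟩

theorem Alg.st_succ (M : Alg Ω p 𝒳 n k X) (i j : ℕ) (ω : Ω) :
    M.st i (j + 1) ω = if j < n ∧ i < k then M.f i j (X j ω) (M.st i j ω) (M.R i j ω)
      else M.st i j ω := rfl

theorem Alg.st_eq_of_agreeOn (M : Alg Ω p 𝒳 n k X) {P : ℕ → Prop} {ω ω' : Ω}
    (h : M.AgreeOn P ω ω') {i a b : ℕ} (hab : a ≤ b) (hP : ∀ j, a ≤ j → j < b → P j)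
    (h0 : M.st i a ω = M.st i a ω') : M.st i b ω = M.st i b ω' := by
  induction b, hab using Nat.le_induction with
  | base => exact h0
  | succ b hab ih =>
    have ih := ih fun j h1 h2 => hP j h1 (by omega)
    rw [M.st_succ, M.st_succ]
    split_ifs with hc
    · obtain ⟨h1, h2⟩ := h b hc.1 (hP b hab (by omega))
      rw [h1, h2 i hc.2, ih]
    · exact ih

/-- The states at position `c` in the first `a` passes and at position `d` in the first `b`
passes. -/
def Alg.cut (M : Alg Ω p 𝒳 n k X) (c d a b : ℕ) (ω : Ω) : (Fin a → M.S) × (Fin b → M.S) :=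
  (fun r => M.st r c ω, fun r => M.st r d ω)

theorem Alg.cut_eq_iff (M : Alg Ω p 𝒳 n k X) {c d a b : ℕ} {ω ω' : Ω} :
    M.cut c d a b ω = M.cut c d a b ω' ↔
      (∀ r < a, M.st r c ω = M.st r c ω') ∧ ∀ r < b, M.st r d ω = M.st r d ω' := by
  simp only [Alg.cut, Prod.mk.injEq, funext_iff, Fin.forall_iff]

theorem Alg.cut_swap_eq_iff (M : Alg Ω p 𝒳 n k X) (c d a b : ℕ) (ω ω' : Ω) :
    M.cut c d a b ω = M.cut c d a b ω' ↔ M.cut d c b a ω = M.cut d c b a ω' := by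
  rw [M.cut_eq_iff, M.cut_eq_iff, and_comm]

theorem Alg.AgreeOut.st_before {M : Alg Ω p 𝒳 n k X} {c d : ℕ} {ω ω' : Ω} (hdn : d ≤ n)
    (h : M.AgreeOut c d ω ω') {r j : ℕ} (hj : j ≤ c)
    (hd : ∀ s < r, M.st s d ω = M.st s d ω') : M.st r j ω = M.st r j ω' := by
  refine M.st_eq_of_agreeOn h.2 (Nat.zero_le j) (fun _ _ _ => by omega) ?_
  cases r with
  | zero => exact h.1
  | succ r =>
    change M.st r n ω = M.st r n ω'
    exact M.st_eq_of_agreeOn h.2 hdn (fun _ _ _ => by omega) (hd r (by omega))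

theorem Alg.AgreeOut.st_outside {M : Alg Ω p 𝒳 n k X} {c d : ℕ} {ω ω' : Ω} (hdn : d ≤ n)
    (h : M.AgreeOut c d ω ω') {b r j : ℕ} (hj : j ≤ c ∨ d ≤ j) (hr : r < b)
    (hd : ∀ s < b, M.st s d ω = M.st s d ω') : M.st r j ω = M.st r j ω' := by
  rcases hj with hj | hj
  · exact h.st_before hdn hj fun s hs => hd s (by omega)
  · exact M.st_eq_of_agreeOn h.2 hj (fun _ _ _ => by omega) (hd r hr)

theorem Alg.AgreeIn.st_inside {M : Alg Ω p 𝒳 n k X} {c d : ℕ} {ω ω' : Ω}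
    (h : M.AgreeIn c d ω ω') {r j : ℕ} (hc : c ≤ j) (hd : j ≤ d)
    (h0 : M.st r c ω = M.st r c ω') : M.st r j ω = M.st r j ω' :=
  M.st_eq_of_agreeOn h hc (fun _ _ _ => by omega) h0

theorem Alg.cut_rect (M : Alg Ω p 𝒳 n k X) {c d a b : ℕ} (hcd : c ≤ d) (hdn : d ≤ n)
    (hba : b ≤ a) (hab : a ≤ b + 1) (ω ω' ω'' : Ω) (hin : M.AgreeIn c d ω'' ω)
    (hout : M.AgreeOut c d ω'' ω') (h : M.cut c d a b ω = M.cut c d a b ω') :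
    M.cut c d a b ω'' = M.cut c d a b ω := by
  rw [M.cut_eq_iff] at h ⊢
  have key : ∀ r ≤ b, ∀ s < r, M.st s d ω'' = M.st s d ω := by
    intro r
    induction r with
    | zero => intro _ s hs; omega
    | succ r ih =>
      intro hr s hs
      rcases Nat.lt_succ_iff_lt_or_eq.1 hs with hs | rfl
      · exact ih (by omega) s hs
      · refine hin.st_inside hcd le_rfl ?_
        rw [h.1 s (by omega)]
        refine hout.st_before hdn le_rfl fun u hu => ?_
        rw [ih (by omega) u hu, h.2 u (by omega)]
  refine ⟨fun r hr => ?_, fun r hr => key b le_rfl r hr⟩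
  rw [h.1 r hr]
  refine hout.st_before hdn le_rfl fun u hu => ?_
  rw [key b le_rfl u (by omega), h.2 u (by omega)]

/-- The states at the two ends of a block separate the inside of the block from its outside. -/
theorem Alg.condIndep_cut (M : Alg Ω p 𝒳 n k X) (hp : IsPMF p) {κ : ℝ}
    (hX : ∀ x : Fin n → 𝒳, pr p (fun ω => ∀ j : Fin n, X j.1 ω = x j) = κ)
    {c d a b : ℕ} (hcd : c ≤ d) (hdn : d ≤ n) (hba : b ≤ a) (hab : a ≤ b + 1) {Φ Ψ : Ω → ℝ}
    (hΦ : ∀ ω ω', M.AgreeIn c d ω ω' → M.cut c d a b ω = M.cut c d a b ω' → Φ ω = Φ ω')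
    (hΨ : ∀ ω ω', M.AgreeOut c d ω ω' → M.cut c d a b ω = M.cut c d a b ω' → Ψ ω = Ψ ω') :
    CondIndep p (M.cut c d a b) Φ Ψ :=
  M.condIndep hp hX c d (M.cut_rect hcd hdn hba hab) hΦ hΨ

theorem ind_eq_of_eq {Ω β : Type} {B : Ω → β} {ω ω' : Ω} (h : B ω = B ω') (b : β) :
    ind (fun ω => B ω = b) ω = ind (fun ω => B ω = b) ω' := by
  simp only [ind, h]

theorem Alg.condMI_linear (M : Alg Ω p 𝒳 n k X) (hp : IsPMF p) {κ : ℝ}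
    (hX : ∀ x : Fin n → 𝒳, pr p (fun ω => ∀ j : Fin n, X j.1 ω = x j) = κ)
    {l e : ℕ} (hle : l < e) (hen : e ≤ n) (i : ℕ) :
    condMI p (M.st i e) (X l) (M.cut l e (i + 1) i) =
      logPost p (X l) (M.cut l e (i + 1) (i + 1)) - logPost p (X l) (M.cut l e i i) := by
  rw [condMI_eq_sub_logPost hp]
  congr 1
  · refine logPost_congr (fun ω ω' => ?_) _
    simp only [Prod.mk.injEq, M.cut_eq_iff, Nat.forall_lt_succ_right]
    tauto
  · rw [logPost_congr (C' := fun ω => (M.st i l ω, M.cut l e i i ω))]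
    · refine CondIndep.logPost_pair hp fun b z =>
        M.condIndep_cut hp hX hle.le hen le_rfl (Nat.le_succ i) ?_ ?_
      · intro ω ω' h _
        exact ind_eq_of_eq (h l (by omega) ⟨le_rfl, hle⟩).1 b
      · intro ω ω' h hC
        exact ind_eq_of_eq (h.st_before hen le_rfl (M.cut_eq_iff.1 hC).2) z
    · intro ω ω'
      simp only [Prod.mk.injEq, M.cut_eq_iff, Nat.forall_lt_succ_right]
      tauto

theorem Alg.condMI_cyclic (M : Alg Ω p 𝒳 n k X) (hp : IsPMF p) {κ : ℝ}
    (hX : ∀ x : Fin n → 𝒳, pr p (fun ω => ∀ j : Fin n, X j.1 ω = x j) = κ)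
    {l e : ℕ} (hel : e ≤ l) (hln : l < n) (i : ℕ) :
    condMI p (M.st i e) (X l) (M.cut l e i i) =
      logPost p (X l) (M.cut l e (i + 1) (i + 1)) - logPost p (X l) (M.cut l e i i) := by
  rw [condMI_eq_sub_logPost hp]
  congr 1
  have e1 : logPost p (X l) (M.cut l e (i + 1) (i + 1)) =
      logPost p (X l) (fun ω => (M.st i l ω, M.cut e l (i + 1) i ω)) := by
    refine logPost_congr (fun ω ω' => ?_) _
    simp only [Prod.mk.injEq, M.cut_eq_iff, Nat.forall_lt_succ_right]
    tauto
  have e2 : logPost p (X l) (fun ω => (M.st i e ω, M.cut l e i i ω)) =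
      logPost p (X l) (M.cut e l (i + 1) i) := by
    refine logPost_congr (fun ω ω' => ?_) _
    simp only [Prod.mk.injEq, M.cut_eq_iff, Nat.forall_lt_succ_right]
    tauto
  rw [e1, e2, eq_comm]
  refine CondIndep.logPost_pair hp fun b z => CondIndep.symm <|
    M.condIndep_cut hp hX hel hln.le (Nat.le_succ i) le_rfl ?_ ?_
  · intro ω ω' h hC
    exact ind_eq_of_eq (h.st_inside hel le_rfl ((M.cut_eq_iff.1 hC).1 i (by omega))) z
  · intro ω ω' h _
    exact ind_eq_of_eq (h.2 l hln (by omega)).1 b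

/-- The information about `X l` revealed by all the states at the positions `l` and `e`. -/
def Alg.pairCost (M : Alg Ω p 𝒳 n k X) (l e : ℕ) : ℝ :=
  logPost p (X l) (M.cut l e k k) - logPost p (X l) (M.cut l e 0 0)

theorem Alg.MIC_eq_sum_pairCost (M : Alg Ω p 𝒳 n k X) (hp : IsPMF p) {κ : ℝ}
    (hX : ∀ x : Fin n → 𝒳, pr p (fun ω => ∀ j : Fin n, X j.1 ω = x j) = κ) :
    M.MIC = ∑ j ∈ Finset.range n, ∑ l ∈ Finset.range n, M.pairCost l (j + 1) := by
  have h1 : M.MIC =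
      (∑ i ∈ Finset.range k, ∑ j ∈ Finset.range n, ∑ l ∈ Finset.range (j + 1),
        condMI p (M.st i (j + 1)) (X l) (M.cut l (j + 1) (i + 1) i)) +
      ∑ i ∈ Finset.range k, ∑ j ∈ Finset.range n, ∑ l ∈ Finset.Ico (j + 1) n,
        condMI p (M.st i (j + 1)) (X l) (M.cut l (j + 1) i i) := rfl
  rw [h1, Finset.sum_comm, Finset.sum_comm (s := Finset.range k), ← Finset.sum_add_distrib]
  refine Finset.sum_congr rfl fun j hj => ?_
  rw [Finset.mem_range] at hj
  rw [← Finset.sum_range_add_sum_Ico _ (show j + 1 ≤ n by omega), Finset.sum_comm,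
    Finset.sum_comm (s := Finset.range k)]
  congr 1
  · refine Finset.sum_congr rfl fun l hl => ?_
    rw [Finset.mem_range] at hl
    rw [Finset.sum_congr rfl fun i _ => M.condMI_linear hp hX hl (by omega) i]
    exact Finset.sum_range_sub (fun i => logPost p (X l) (M.cut l (j + 1) i i)) k
  · refine Finset.sum_congr rfl fun l hl => ?_
    rw [Finset.mem_Ico] at hl
    rw [Finset.sum_congr rfl fun i _ => M.condMI_cyclic hp hX hl.1 hl.2 i]
    exact Finset.sum_range_sub (fun i => logPost p (X l) (M.cut l (j + 1) i i)) k

theorem Alg.sum_prod_replace (M : Alg Ω p 𝒳 n k X) (hp : IsPMF p) {κ : ℝ}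
    (hX : ∀ x : Fin n → 𝒳, pr p (fun ω => ∀ j : Fin n, X j.1 ω = x j) = κ) (hk : 1 ≤ k)
    (hfix : ∀ j ≤ n, ∀ ω, M.st (k - 1) j ω = M.passEnd (k - 1) ω)
    {T : Finset ℕ} (hT : T ⊆ Finset.range n) {e : ℕ → ℕ}
    (he : ∀ b ∈ T, e b ∈ T ∨ (e b = n ∧ 0 ∈ T))
    (hcase : ∀ a ∈ T, (a < e a ∧ ∀ b ∈ T, b ≤ a ∨ e a ≤ b) ∨
      (1 ≤ e a ∧ e a ≤ a ∧ ∀ b ∈ T, e a ≤ b ∧ b ≤ a))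
    (g : M.S → ℝ) (s : ℝ) (α : 𝒳) :
    ∑ ω, p ω * (g (M.passEnd k ω) * ∏ l ∈ T, (1 + s * ind (fun ω => X l ω = α) ω) / 2) =
      ∑ ω, p ω * (g (M.passEnd k ω) *
        ∏ l ∈ T, (1 + s * ce p (ind fun ω => X l ω = α) (M.cut l (e l) k k) ω) / 2) := by
  have hTn : ∀ b ∈ T, b < n := fun b hb => Finset.mem_range.1 (hT hb)
  have hen : ∀ b ∈ T, e b ≤ n := fun b hb => by
    rcases he b hb with h | h
    · exact (hTn _ h).le
    · exact h.1.le
  have hend : ∀ a ≤ n, ∀ ω, M.passEnd k ω = M.st (k - 1) a ω := by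
    intro a ha ω
    rw [hfix a ha, ← hfix n le_rfl]
    obtain ⟨k', rfl⟩ := Nat.exists_eq_succ_of_ne_zero (by omega : k ≠ 0)
    rfl
  let y (l : ℕ) (ω : Ω) : ℝ := (1 + s * ind (fun ω => X l ω = α) ω) / 2
  let z (l : ℕ) (ω : Ω) : ℝ :=
    (1 + s * ce p (ind fun ω => X l ω = α) (M.cut l (e l) k k) ω) / 2
  have hz : ∀ b ω ω', M.cut b (e b) k k ω = M.cut b (e b) k k ω' → z b ω = z b ω' := by
    intro b ω ω' h
    simp only [z, ce, h]
  have main : ∀ S ⊆ T, ∑ ω, p ω * (g (M.passEnd k ω) * ∏ l ∈ T, y l ω) =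
      ∑ ω, p ω * (g (M.passEnd k ω) * ((∏ l ∈ S, z l ω) * ∏ l ∈ T \ S, y l ω)) := by
    intro S
    induction S using Finset.induction_on with
    | empty => simp
    | insert a S haS ih =>
      intro hS
      have haT : a ∈ T := hS (Finset.mem_insert_self a S)
      rw [ih ((Finset.subset_insert a S).trans hS)]
      let F (ω : Ω) : ℝ :=
        g (M.passEnd k ω) * ((∏ l ∈ S, z l ω) * ∏ l ∈ T \ insert a S, y l ω)
      have hF : ∀ ω ω', M.st (k - 1) a ω = M.st (k - 1) a ω' →
          (∀ b ∈ T, ∀ r < k, M.st r b ω = M.st r b ω') →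
          (∀ b ∈ T, ∀ r < k, M.st r (e b) ω = M.st r (e b) ω') →
          (∀ b ∈ T, b ≠ a → X b ω = X b ω') → F ω = F ω' := by
        intro ω ω' h1 h2 h3 h4
        simp only [F]
        rw [hend a (hTn a haT).le ω, hend a (hTn a haT).le ω', h1]
        congr 2
        · refine Finset.prod_congr rfl fun b hb => hz b ω ω' ?_
          have hb := hS (Finset.mem_insert_of_mem hb)
          exact M.cut_eq_iff.2 ⟨h2 b hb, h3 b hb⟩
        · refine Finset.prod_congr rfl fun b hb => ?_
          rw [Finset.mem_sdiff, Finset.mem_insert, not_or] at hb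
          simp only [y]
          rw [ind_eq_of_eq (h4 b hb.1 hb.2.1)]
      have hCI : CondIndep p (M.cut a (e a) k k) (ind fun ω => X a ω = α) F := by
        rcases hcase a haT with ⟨hlt, hb⟩ | ⟨h1, hle, hb⟩
        · refine M.condIndep_cut hp hX hlt.le (hen a haT) le_rfl (Nat.le_succ k) ?_ ?_
          · intro ω ω' h _
            exact ind_eq_of_eq (h a (hTn a haT) ⟨le_rfl, hlt⟩).1 α
          · intro ω ω' h hC
            rw [M.cut_eq_iff] at hC
            refine hF ω ω' (hC.1 _ (by omega)) ?_ ?_ ?_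
            · exact fun b hbT r hr => h.st_outside (hen a haT) (hb b hbT) hr hC.2
            · intro b hbT r hr
              refine h.st_outside (hen a haT) ?_ hr hC.2
              rcases he b hbT with h' | h'
              · exact hb _ h'
              · exact Or.inr (h'.1 ▸ hen a haT)
            · intro b hbT hba
              refine (h.2 b (hTn b hbT) ?_).1
              have := hb b hbT
              omega
        · refine CondIndep.congr (M.cut_swap_eq_iff (e a) a k k) (CondIndep.symm ?_)
          refine M.condIndep_cut hp hX hle (hTn a haT).le le_rfl (Nat.le_succ k) ?_ ?_
          · intro ω ω' h hC
            rw [M.cut_eq_iff] at hC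
            refine hF ω ω' (hC.2 _ (by omega)) ?_ ?_ ?_
            · exact fun b hbT r hr => h.st_inside (hb b hbT).1 (hb b hbT).2 (hC.1 r hr)
            · intro b hbT r hr
              rcases he b hbT with h' | h'
              · exact h.st_inside (hb _ h').1 (hb _ h').2 (hC.1 r hr)
              · have := (hb 0 h'.2).1
                omega
            · intro b hbT hba
              refine (h b (hTn b hbT) ?_).1
              have := hb b hbT
              omega
          · intro ω ω' h _
            exact ind_eq_of_eq (h.2 a (hTn a haT) (by omega)).1 α
      have hsd : T \ S = insert a (T \ insert a S) := by
        ext b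
        simp only [Finset.mem_sdiff, Finset.mem_insert]
        by_cases hb : b = a
        · subst hb; simp [haS, haT]
        · simp [hb]
      have hnot : a ∉ T \ insert a S := by simp
      have key := hCI.sum_ce_mul hp
      have e1 : ∀ ω, p ω * (g (M.passEnd k ω) * ((∏ l ∈ S, z l ω) * ∏ l ∈ T \ S, y l ω)) =
          p ω * F ω / 2 + s / 2 * (p ω * (ind (fun ω => X a ω = α) ω * F ω)) := by
        intro ω
        rw [hsd, Finset.prod_insert hnot]
        simp only [F, y]
        ring
      have e2 : ∀ ω, p ω * (g (M.passEnd k ω) *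
          ((∏ l ∈ insert a S, z l ω) * ∏ l ∈ T \ insert a S, y l ω)) =
          p ω * F ω / 2 + s / 2 * (p ω *
            (ce p (ind fun ω => X a ω = α) (M.cut a (e a) k k) ω * F ω)) := by
        intro ω
        rw [Finset.prod_insert haS]
        simp only [F, z]
        ring
      simp only [e1, e2, Finset.sum_add_distrib, ← Finset.mul_sum, key]
  simpa only [Finset.sdiff_self, Finset.prod_empty, mul_one] using main T Finset.Subset.rfl

end Streaming

theorem exists_cyclic_successor {n : ℕ} {T : Finset ℕ} (hT : T ⊆ Finset.range n)
    (hcard : 2 ≤ T.card) :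
    ∃ e' : ℕ → ℕ, ∀ a ∈ T, e' a ∈ T ∧ e' a ≠ a ∧
      let e := if e' a = 0 then n else e' a
      (a < e ∧ ∀ b ∈ T, b ≤ a ∨ e ≤ b) ∨ (1 ≤ e ∧ e ≤ a ∧ ∀ b ∈ T, e ≤ b ∧ b ≤ a) := by
  suffices h : ∀ a, ∃ c, a ∈ T → c ∈ T ∧ c ≠ a ∧
      let e := if c = 0 then n else c
      (a < e ∧ ∀ b ∈ T, b ≤ a ∨ e ≤ b) ∨ (1 ≤ e ∧ e ≤ a ∧ ∀ b ∈ T, e ≤ b ∧ b ≤ a) from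
    ⟨fun a => (h a).choose, fun a => (h a).choose_spec⟩
  intro a
  by_cases hlast : ∃ b ∈ T, a < b
  · have hne : (T.filter (a < ·)).Nonempty := by
      obtain ⟨b, hb, hab⟩ := hlast
      exact ⟨b, Finset.mem_filter.2 ⟨hb, hab⟩⟩
    have hmem := Finset.min'_mem _ hne
    rw [Finset.mem_filter] at hmem
    refine ⟨_, fun _ => ⟨hmem.1, hmem.2.ne', Or.inl ?_⟩⟩
    rw [if_neg (by omega)]
    refine ⟨hmem.2, fun b hb => ?_⟩
    rcases le_or_gt b a with h | h
    · exact Or.inl h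
    · exact Or.inr (Finset.min'_le _ _ (Finset.mem_filter.2 ⟨hb, h⟩))
  · push Not at hlast
    have hne : T.Nonempty := Finset.card_pos.1 (by omega)
    have hmin := fun b hb => Finset.min'_le T b hb
    have hmem := Finset.min'_mem T hne
    refine ⟨T.min' hne, fun ha => ⟨hmem, ?_, ?_⟩⟩
    · obtain ⟨b, hb, hba⟩ := Finset.exists_mem_ne (show 1 < T.card by omega) a
      have := hmin b hb
      have := hlast b hb
      omega
    · have han := Finset.mem_range.1 (hT ha)
      dsimp only
      split_ifs with h0
      · exact Or.inl ⟨han, fun b hb => Or.inl (hlast b hb)⟩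
      · exact Or.inr ⟨by omega, hmin a ha, fun b hb => ⟨hmin b hb, hlast b hb⟩⟩

theorem neg_log_half_one_add_le {r : ℝ} (hr : 0 ≤ r) :
    -Real.log ((1 + r) / 2) ≤ (r * Real.log r - r + 1) - (r - 1) / 2 := by
  have h1 : -Real.log ((1 + r) / 2) ≤ 2 / (1 + r) - 1 := by
    have := Real.one_sub_inv_le_log_of_pos (show 0 < (1 + r) / 2 by positivity)
    rw [inv_div] at this
    linarith
  have h2 : (√r - 1) ^ 2 ≤ r * Real.log r - r + 1 := by
    rcases hr.eq_or_lt with h0 | h0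
    · simp [← h0]
    · have hs : 0 < √r := Real.sqrt_pos.2 h0
      have hss : r = √r * √r := (Real.mul_self_sqrt hr).symm
      have hlog : Real.log r = 2 * Real.log √r := by rw [Real.log_sqrt hr]; ring
      have h := Real.one_sub_inv_le_log_of_pos hs
      have h' : √r * √r - √r ≤ √r * √r * Real.log √r := by
        have := mul_le_mul_of_nonneg_left h (mul_pos hs hs).le
        have e : √r * √r * (1 - (√r)⁻¹) = √r * √r - √r := by field_simp
        linarith
      rw [hlog]
      have e1 : r * (2 * Real.log √r) = 2 * (√r * √r * Real.log √r) := by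
        rw [← hss]; ring
      nlinarith
  have h3 : 2 / (1 + r) - 1 + (r - 1) / 2 ≤ (√r - 1) ^ 2 := by
    have hs := Real.sqrt_nonneg r
    have hss : √r ^ 2 = r := Real.sq_sqrt hr
    have e : 2 / (1 + r) - 1 + (r - 1) / 2 = (r - 1) ^ 2 / (2 * (1 + r)) := by
      field_simp
      ring
    rw [e, div_le_iff₀ (by positivity)]
    have e2 : (r - 1) ^ 2 = (√r - 1) ^ 2 * (√r + 1) ^ 2 := by
      rw [← mul_pow]
      congr 1
      linear_combination -hss
    rw [e2]
    refine mul_le_mul_of_nonneg_left ?_ (sq_nonneg _)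
    nlinarith [sq_nonneg (√r - 1)]
  linarith

theorem mul_log_sub_self_add_one_nonneg {r : ℝ} (hr : 0 ≤ r) :
    0 ≤ r * Real.log r - r + 1 := by
  rcases hr.eq_or_lt with h0 | h0
  · simp [← h0]
  · have h := mul_le_mul_of_nonneg_left (Real.one_sub_inv_le_log_of_pos h0) hr
    have e : r * (1 - r⁻¹) = r - 1 := by field_simp
    linarith

/-- Interpolates the tangent lines of `-log` at `exp (-1)` and at `1`. -/
theorem le_neg_log_of_mem_unit {g L : ℝ} (h0 : 0 ≤ g) (h1 : g ≤ 1) (hL : 0 < L) :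
    g * (2 - Real.exp 1 * L) + (1 - g) * (1 - L) ≤ -Real.log L := by
  have a1 : 1 - L ≤ -Real.log L := by linarith [Real.log_le_sub_one_of_pos hL]
  have a2 : 2 - Real.exp 1 * L ≤ -Real.log L := by
    have := Real.log_le_sub_one_of_pos (mul_pos (Real.exp_pos 1) hL)
    rw [Real.log_mul (Real.exp_pos 1).ne' hL.ne', Real.log_exp] at this
    linarith
  have := mul_le_mul_of_nonneg_left a2 h0
  have := mul_le_mul_of_nonneg_left a1 (sub_nonneg.2 h1)
  linarith

theorem sum_powerset_mem_pair {s : Finset ℕ} {θ : ℝ} {a b : ℕ} (ha : a ∈ s) (hb : b ∈ s)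
    (hab : a ≠ b) :
    (∑ T ∈ s.powerset, if a ∈ T ∧ b ∈ T then (∏ _i ∈ T, θ) * ∏ _i ∈ s \ T, (1 - θ) else 0) =
      θ ^ 2 := by
  have h := Finset.prod_add (fun _ => θ) (fun i => if i = a ∨ i = b then 0 else 1 - θ) s
  have e1 : ∀ T ∈ s.powerset,
      (if a ∈ T ∧ b ∈ T then (∏ _i ∈ T, θ) * ∏ _i ∈ s \ T, (1 - θ) else 0) =
      (∏ _i ∈ T, θ) * ∏ i ∈ s \ T, if i = a ∨ i = b then 0 else 1 - θ := by
    intro T _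
    split_ifs with hT
    · congr 1
      refine Finset.prod_congr rfl fun i hi => ?_
      rw [if_neg]
      rintro (rfl | rfl)
      · exact (Finset.mem_sdiff.1 hi).2 hT.1
      · exact (Finset.mem_sdiff.1 hi).2 hT.2
    · symm
      apply mul_eq_zero_of_right
      rw [not_and_or] at hT
      rcases hT with hT | hT
      · exact Finset.prod_eq_zero (Finset.mem_sdiff.2 ⟨ha, hT⟩) (by simp)
      · exact Finset.prod_eq_zero (Finset.mem_sdiff.2 ⟨hb, hT⟩) (by simp)
  rw [Finset.sum_congr rfl e1, ← h]
  have e2 : ∀ i ∈ s, θ + (if i = a ∨ i = b then 0 else 1 - θ) =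
      (if i = a then θ else 1) * (if i = b then θ else 1) := by
    intro i _
    by_cases h1 : i = a
    · subst h1; simp [hab]
    · by_cases h2 : i = b
      · subst h2; simp [h1]
      · simp [h1, h2]
  rw [Finset.prod_congr rfl e2, Finset.prod_mul_distrib, Finset.prod_ite_eq' , Finset.prod_ite_eq']
  simp only [ha, hb, if_true]
  ring

section Uniform

variable {Ω : Type} [Fintype Ω] {p : Ω → ℝ} {t n k : ℕ} {X : ℕ → Ω → Fin t}

theorem sum_eq_sum_stream
    (hX : ∀ x : Fin n → Fin t, pr p (fun ω => ∀ j : Fin n, X j.1 ω = x j) = (1 / (t : ℝ)) ^ n)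
    (h : (Fin n → Fin t) → ℝ) :
    ∑ ω, p ω * h (fun j => X j ω) = ∑ x, (1 / (t : ℝ)) ^ n * h x := by
  rw [← sum_pr_mul (fun ω => fun j : Fin n => X j ω) h]
  simp only [funext_iff, hX]

theorem sum_prod_uniform
    (hX : ∀ x : Fin n → Fin t, pr p (fun ω => ∀ j : Fin n, X j.1 ω = x j) = (1 / (t : ℝ)) ^ n)
    (f : ℕ → Fin t → ℝ) {T : Finset ℕ} (hT : T ⊆ Finset.range n) (ht : 0 < t) :
    ∑ ω, p ω * ∏ l ∈ T, f l (X l ω) = ∏ l ∈ T, (1 / (t : ℝ) * ∑ a, f l a) := by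
  have ht' : (t : ℝ) ≠ 0 := by positivity
  have e (h : ℕ → ℝ) : ∏ l ∈ T, h l = ∏ j : Fin n, if (j : ℕ) ∈ T then h j else 1 := by
    rw [Fin.prod_univ_eq_prod_range (fun j => if j ∈ T then h j else 1) n,
      Finset.prod_ite_mem, Finset.inter_eq_right.2 hT]
  simp only [e]
  rw [sum_eq_sum_stream hX fun x => ∏ j : Fin n, if (j : ℕ) ∈ T then f j (x j) else 1,
    ← Finset.mul_sum]
  have e2 := Finset.prod_univ_sum (fun _ : Fin n => (Finset.univ : Finset (Fin t)))
    (fun j a => if (j : ℕ) ∈ T then f j a else 1)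
  rw [Fintype.piFinset_univ] at e2
  rw [← e2]
  have e3 : (1 / (t : ℝ)) ^ n = ∏ _j : Fin n, 1 / (t : ℝ) := by simp
  rw [e3, ← Finset.prod_mul_distrib]
  refine Finset.prod_congr rfl fun j _ => ?_
  split_ifs
  · rfl
  · simp [ht']

theorem sum_half_one_add_ind (ht : 0 < t) (x : Fin t) :
    1 / (t : ℝ) * ∑ a, (1 + (t : ℝ) * (if x = a then 1 else 0)) / 2 = 1 := by
  have ht' : (t : ℝ) ≠ 0 := by positivity
  rw [← Finset.sum_div, Finset.sum_add_distrib, ← Finset.mul_sum, Finset.sum_ite_eq]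
  simp only [Finset.sum_const, Finset.card_univ, Fintype.card_fin, nsmul_eq_mul, Finset.mem_univ,
    if_true]
  field_simp
  norm_num

/-- The Kullback–Leibler form of `Alg.pairCost`, in nats. -/
def Alg.klCost (M : Alg Ω p (Fin t) n k X) (l e : ℕ) : ℝ :=
  ∑ ω, p ω * ∑ α : Fin t, 1 / (t : ℝ) *
    ((t * ce p (ind fun ω => X l ω = α) (M.cut l e k k) ω) *
        Real.log (t * ce p (ind fun ω => X l ω = α) (M.cut l e k k) ω) -
      t * ce p (ind fun ω => X l ω = α) (M.cut l e k k) ω + 1)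

theorem Alg.klCost_nonneg (M : Alg Ω p (Fin t) n k X) (hp : IsPMF p) (l e : ℕ) :
    0 ≤ M.klCost l e :=
  Finset.sum_nonneg fun ω _ => mul_nonneg (hp.nonneg ω) <| Finset.sum_nonneg fun α _ =>
    mul_nonneg (by positivity) <| mul_log_sub_self_add_one_nonneg <|
      mul_nonneg (by positivity) (ce_nonneg hp (ind_nonneg _) _ _)

theorem Alg.klCost_eq (M : Alg Ω p (Fin t) n k X) (hp : IsPMF p) (ht : 0 < t)
    (hX : ∀ x : Fin n → Fin t, pr p (fun ω => ∀ j : Fin n, X j.1 ω = x j) = (1 / (t : ℝ)) ^ n)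
    {l : ℕ} (hl : l < n) (e : ℕ) : M.klCost l e = Real.log 2 * M.pairCost l e := by
  have ht' : (0 : ℝ) < t := by positivity
  have hlog2 : Real.log 2 ≠ 0 := (Real.log_pos one_lt_two).ne'
  let c (α : Fin t) (ω : Ω) : ℝ := ce p (ind fun ω => X l ω = α) (M.cut l e k k) ω
  have hmarg : ∀ α, pr p (fun ω => X l ω = α) = 1 / t := by
    intro α
    have := sum_prod_uniform hX (fun _ => ind fun a => a = α)
      (Finset.singleton_subset_iff.2 (Finset.mem_range.2 hl)) ht
    have e1 : ∑ a, ind (fun a => a = α) a = 1 :=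
      (Finset.sum_eq_single α (fun b _ hb => if_neg hb) (by simp)).trans (if_pos rfl)
    simp only [Finset.prod_singleton, e1, mul_one] at this
    rw [← this]
    exact Finset.sum_congr rfl fun ω _ => by by_cases h : X l ω = α <;> simp [ind, h]
  have h0 : logPost p (X l) (M.cut l e 0 0) = - Real.logb 2 t := by
    have hC : ∀ ω ω', M.cut l e 0 0 ω = M.cut l e 0 0 ω' := fun ω ω' => Subsingleton.elim _ _
    have : ∀ ω, ce p (ind fun ω' => X l ω' = X l ω) (M.cut l e 0 0) ω = (t : ℝ)⁻¹ := by
      intro ω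
      have e1 : pr p (fun _ => True) = 1 := by simpa [pr] using hp.sum_one
      simp only [ce, hC _ ω, exOn_ind, and_true, hmarg, e1]
      simp
    simp only [logPost, this, Real.logb_inv, ← Finset.sum_mul, hp.sum_one, one_mul]
  have h1 : M.klCost l e = ∑ ω, ∑ α, p ω * (c α ω * Real.log (t * c α ω)) := by
    refine Finset.sum_congr rfl fun ω _ => ?_
    rcases (hp.nonneg ω).eq_or_lt with h | h
    · simp [← h]
    rw [← Finset.mul_sum (f := fun α => c α ω * Real.log (t * c α ω))]
    congr 1
    have hsum : ∑ α, c α ω = 1 := sum_ce_ind hp (X l) _ h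
    have e1 : ∀ α, 1 / (t : ℝ) * ((t * c α ω) * Real.log (t * c α ω) - t * c α ω + 1) =
        c α ω * Real.log (t * c α ω) - c α ω + 1 / t := by
      intro α; field_simp
    simp only [c] at e1 hsum ⊢
    simp only [e1, Finset.sum_add_distrib, Finset.sum_sub_distrib, hsum]
    simp [ht'.ne']
  have h2 : ∀ α, ∑ ω, p ω * (c α ω * Real.log (t * c α ω)) =
      ∑ ω, p ω * (ind (fun ω => X l ω = α) ω * Real.log (t * c α ω)) := fun α =>
    (CondIndep.of_measurable (M.cut l e k k) (ind fun ω => X l ω = α)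
      (Ψ := fun ω => Real.log (t * c α ω)) fun ω ω' h => by simp only [c, ce, h]).sum_ce_mul hp
  rw [h1, Finset.sum_comm, Finset.sum_congr rfl fun α _ => h2 α, Finset.sum_comm, Alg.pairCost, h0,
    sub_neg_eq_add, logPost]
  have h3 : Real.logb 2 t = ∑ ω, p ω * Real.logb 2 t := by
    rw [← Finset.sum_mul, hp.sum_one, one_mul]
  rw [h3, ← Finset.sum_add_distrib, Finset.mul_sum]
  refine Finset.sum_congr rfl fun ω _ => ?_
  rcases (hp.nonneg ω).eq_or_lt with h | h
  · simp [← h]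
  have hpos : 0 < c (X l ω) ω := by
    simp only [c, ce, exOn_ind]
    exact div_pos (pr_pos hp (ω := ω) ⟨rfl, rfl⟩ h) (pr_pos hp (ω := ω) rfl h)
  rw [Finset.sum_eq_single (X l ω)]
  · simp only [ind, if_true, one_mul]
    rw [Real.log_mul ht'.ne' hpos.ne', ← mul_add, Real.logb, Real.logb]
    change _ = Real.log 2 * (p ω * (Real.log (c (X l ω) ω) / _ + _))
    field_simp
    ring
  · intro α _ hα
    simp [ind, hα.symm]
  · simp

theorem Alg.sum_klCost_eq_MIC (M : Alg Ω p (Fin t) n k X) (hp : IsPMF p) (ht : 0 < t)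
    (hX : ∀ x : Fin n → Fin t, pr p (fun ω => ∀ j : Fin n, X j.1 ω = x j) = (1 / (t : ℝ)) ^ n) :
    ∑ l ∈ Finset.range n, ∑ e ∈ Finset.range n, M.klCost l (if e = 0 then n else e) =
      Real.log 2 * M.MIC := by
  rw [M.MIC_eq_sum_pairCost hp hX, Finset.sum_comm (f := fun j l => M.pairCost l (j + 1)),
    Finset.mul_sum]
  refine Finset.sum_congr rfl fun l hl => ?_
  rw [Finset.mul_sum, Finset.sum_congr rfl fun j _ =>
    (M.klCost_eq hp ht hX (Finset.mem_range.1 hl) (j + 1)).symm]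
  cases n with
  | zero => simp
  | succ m =>
    rw [Finset.sum_range_succ', Finset.sum_range_succ]
    simp

theorem Alg.le_sum_klCost_successor (M : Alg Ω p (Fin t) n k X) (hp : IsPMF p) (ht : 0 < t)
    (hX : ∀ x : Fin n → Fin t, pr p (fun ω => ∀ j : Fin n, X j.1 ω = x j) = (1 / (t : ℝ)) ^ n)
    (hk : 1 ≤ k) (hfix : ∀ j ≤ n, ∀ ω, M.st (k - 1) j ω = M.passEnd (k - 1) ω)
    {T : Finset ℕ} (hT : T ⊆ Finset.range n) {e : ℕ → ℕ}
    (he : ∀ b ∈ T, e b ∈ T ∨ (e b = n ∧ 0 ∈ T))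
    (hcase : ∀ a ∈ T, (a < e a ∧ ∀ b ∈ T, b ≤ a ∨ e a ≤ b) ∨
      (1 ≤ e a ∧ e a ≤ a ∧ ∀ b ∈ T, e a ≤ b ∧ b ≤ a))
    {g : M.S → ℝ} (hg0 : ∀ m, 0 ≤ g m) (hg1 : ∀ m, g m ≤ 1) :
    ∑ ω, p ω * g (M.passEnd k ω) + (1 - Real.exp 1) * ∑ α, 1 / (t : ℝ) * ∑ ω, p ω *
        (g (M.passEnd k ω) * ∏ l ∈ T, (1 + t * ind (fun ω => X l ω = α) ω) / 2) ≤
      ∑ l ∈ T, M.klCost l (e l) := by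
  have ht' : (0 : ℝ) < t := by positivity
  set a := ∑ ω, p ω * g (M.passEnd k ω) with ha
  let r (l : ℕ) (α : Fin t) (ω : Ω) : ℝ :=
    t * ce p (ind fun ω => X l ω = α) (M.cut l (e l) k k) ω
  have hr : ∀ l α ω, 0 ≤ r l α ω := fun l α ω =>
    mul_nonneg ht'.le (ce_nonneg hp (ind_nonneg _) _ _)
  let L (α : Fin t) (ω : Ω) : ℝ := ∏ l ∈ T, (1 + r l α ω) / 2
  have hpos : ∀ l α ω, 0 < (1 + r l α ω) / 2 := fun l α ω => by linarith [hr l α ω]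
  have hL : ∀ α ω, 0 < L α ω := fun α ω => Finset.prod_pos fun l _ => hpos l α ω
  have hrep := M.sum_prod_replace hp hX hk hfix hT he hcase
  have hmean : ∀ α, ∑ ω, p ω * L α ω = 1 := by
    intro α
    have h1 := hrep (fun _ => 1) t α
    simp only [one_mul] at h1
    rw [← h1]
    have h2 := sum_prod_uniform hX (fun _ x => (1 + (t : ℝ) * ind (fun x => x = α) x) / 2) hT ht
    refine h2.trans (Finset.prod_eq_one fun _ _ => ?_)
    refine Eq.trans ?_ (sum_half_one_add_ind ht α)
    congr 1
    refine Finset.sum_congr rfl fun x _ => ?_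
    rcases eq_or_ne x α with h | h
    · simp [ind, h]
    · simp [ind, h, h.symm]
  have hlow : ∀ α, a + (1 - Real.exp 1) * ∑ ω, p ω *
      (g (M.passEnd k ω) * ∏ l ∈ T, (1 + t * ind (fun ω => X l ω = α) ω) / 2) ≤
      ∑ ω, p ω * -Real.log (L α ω) := by
    intro α
    rw [hrep g t α]
    have h1 : ∑ ω, p ω * (g (M.passEnd k ω) * (2 - Real.exp 1 * L α ω) +
        (1 - g (M.passEnd k ω)) * (1 - L α ω)) ≤ ∑ ω, p ω * -Real.log (L α ω) :=
      Finset.sum_le_sum fun ω _ => mul_le_mul_of_nonneg_left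
        (le_neg_log_of_mem_unit (hg0 _) (hg1 _) (hL α ω)) (hp.nonneg ω)
    refine le_trans (le_of_eq ?_) h1
    have h2 : ∀ ω, p ω * (g (M.passEnd k ω) * (2 - Real.exp 1 * L α ω) +
        (1 - g (M.passEnd k ω)) * (1 - L α ω)) =
        p ω * g (M.passEnd k ω) + (1 - Real.exp 1) * (p ω * (g (M.passEnd k ω) * L α ω)) +
          (p ω - p ω * L α ω) := fun ω => by ring
    simp only [h2, Finset.sum_add_distrib, Finset.sum_sub_distrib, hmean, hp.sum_one,
      ← Finset.mul_sum]
    simp [ha, L, r]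
  have hup : ∑ α, 1 / (t : ℝ) * ∑ ω, p ω * -Real.log (L α ω) ≤ ∑ l ∈ T, M.klCost l (e l) := by
    have h1 : ∑ α, 1 / (t : ℝ) * ∑ ω, p ω * -Real.log (L α ω) =
        ∑ l ∈ T, ∑ ω, p ω * ∑ α, 1 / (t : ℝ) * -Real.log ((1 + r l α ω) / 2) := by
      simp only [Finset.mul_sum, L]
      rw [Finset.sum_comm, Finset.sum_comm (s := T)]
      refine Finset.sum_congr rfl fun ω _ => ?_
      rw [Finset.sum_comm (s := T)]
      refine Finset.sum_congr rfl fun α _ => ?_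
      rw [Real.log_prod fun l _ => (hpos l α ω).ne', ← Finset.sum_neg_distrib, Finset.mul_sum,
        Finset.mul_sum]
      exact Finset.sum_congr rfl fun l _ => by ring
    rw [h1]
    refine Finset.sum_le_sum fun l _ => Finset.sum_le_sum fun ω _ => ?_
    rcases (hp.nonneg ω).eq_or_lt with h | h
    · simp [← h]
    refine mul_le_mul_of_nonneg_left ?_ h.le
    have h2 : ∑ α, 1 / (t : ℝ) * -Real.log ((1 + r l α ω) / 2) ≤
        ∑ α, 1 / (t : ℝ) *
          ((r l α ω * Real.log (r l α ω) - r l α ω + 1) - (r l α ω - 1) / 2) :=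
      Finset.sum_le_sum fun α _ => mul_le_mul_of_nonneg_left (neg_log_half_one_add_le (hr l α ω))
        (by positivity)
    refine h2.trans (le_of_eq ?_)
    have h3 : ∑ α, 1 / (t : ℝ) * ((r l α ω - 1) / 2) = 0 := by
      have h4 : ∀ α, 1 / (t : ℝ) * ((r l α ω - 1) / 2) =
          (ce p (ind fun ω => X l ω = α) (M.cut l (e l) k k) ω - 1 / t) / 2 := fun α => by
        simp only [r]; field_simp
      simp only [h4]
      rw [← Finset.sum_div, Finset.sum_sub_distrib, sum_ce_ind hp (X l) _ h]
      simp [ht'.ne']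
    simp only [mul_sub _ _ ((_ - _) / _), Finset.sum_sub_distrib, h3, sub_zero, r]
  refine le_trans (le_of_eq ?_) ((Finset.sum_le_sum fun α _ =>
    mul_le_mul_of_nonneg_left (hlow α) (by positivity)).trans hup)
  simp only [mul_add, Finset.sum_add_distrib, ← Finset.sum_mul]
  congr 1
  · simp [ht'.ne']
  · rw [Finset.mul_sum]
    exact Finset.sum_congr rfl fun α _ => by ring

theorem Alg.le_sum_klCost (M : Alg Ω p (Fin t) n k X) (hp : IsPMF p) (ht : 0 < t)
    (hX : ∀ x : Fin n → Fin t, pr p (fun ω => ∀ j : Fin n, X j.1 ω = x j) = (1 / (t : ℝ)) ^ n)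
    (hk : 1 ≤ k) (hfix : ∀ j ≤ n, ∀ ω, M.st (k - 1) j ω = M.passEnd (k - 1) ω)
    {T : Finset ℕ} (hT : T ⊆ Finset.range n)
    {g : M.S → ℝ} (hg0 : ∀ m, 0 ≤ g m) (hg1 : ∀ m, g m ≤ 1) :
    ∑ ω, p ω * g (M.passEnd k ω) + (1 - Real.exp 1) * ∑ α, 1 / (t : ℝ) * ∑ ω, p ω *
        (g (M.passEnd k ω) * ∏ l ∈ T, (1 + t * ind (fun ω => X l ω = α) ω) / 2) ≤
      ∑ l ∈ T, ∑ e ∈ T, if l ≠ e then M.klCost l (if e = 0 then n else e) else 0 := by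
  have ht' : (0 : ℝ) < t := by positivity
  have hterm : ∀ l e, 0 ≤ if l ≠ e then M.klCost l (if e = 0 then n else e) else 0 := by
    intro l e
    split_ifs <;> simp [M.klCost_nonneg hp]
  rcases lt_or_ge T.card 2 with hc | hc
  · refine le_trans ?_ (Finset.sum_nonneg fun l _ => Finset.sum_nonneg fun e _ => hterm l e)
    have h1 : ∀ ω, ∑ α : Fin t, 1 / (t : ℝ) *
        ∏ l ∈ T, (1 + (t : ℝ) * ind (fun ω => X l ω = α) ω) / 2 = 1 := by
      intro ω
      rcases Finset.card_le_one_iff_subset_singleton.1 (Nat.lt_succ_iff.1 hc) with ⟨l, hl⟩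
      rcases Finset.subset_singleton_iff.1 hl with rfl | rfl
      · simp [ht'.ne']
      · rw [← Finset.mul_sum]
        refine Eq.trans ?_ (sum_half_one_add_ind ht (X l ω))
        congr 1
        refine Finset.sum_congr rfl fun x _ => ?_
        by_cases h : X l ω = x <;> simp [ind, h]
    have h2 : ∑ α, 1 / (t : ℝ) * ∑ ω, p ω * (g (M.passEnd k ω) *
        ∏ l ∈ T, (1 + t * ind (fun ω => X l ω = α) ω) / 2) = ∑ ω, p ω * g (M.passEnd k ω) := by
      simp only [Finset.mul_sum]
      rw [Finset.sum_comm]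
      refine Finset.sum_congr rfl fun ω _ => ?_
      refine Eq.trans ?_ ((congrArg (p ω * g (M.passEnd k ω) * ·) (h1 ω)).trans (mul_one _))
      rw [Finset.mul_sum]
      exact Finset.sum_congr rfl fun α _ => by ring
    rw [h2]
    have h3 : 0 ≤ ∑ ω, p ω * g (M.passEnd k ω) :=
      Finset.sum_nonneg fun ω _ => mul_nonneg (hp.nonneg ω) (hg0 _)
    nlinarith [Real.exp_one_gt_d9]
  · obtain ⟨e', he'⟩ := exists_cyclic_successor hT hc
    refine (M.le_sum_klCost_successor hp ht hX hk hfix hT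
      (e := fun l => if e' l = 0 then n else e' l) (fun b hb => ?_) (fun b hb => (he' b hb).2.2)
      hg0 hg1).trans ?_
    · have := (he' b hb).1
      by_cases h : e' b = 0
      · right; simpa [h] using h ▸ this
      · left; simpa [h] using this
    · refine Finset.sum_le_sum fun l hl => ?_
      refine le_trans (le_of_eq ?_)
        (Finset.single_le_sum (fun e _ => hterm l e) (he' l hl).1)
      rw [if_pos (he' l hl).2.1.symm]

/-- The needle distribution is a mixture, over a random set `T` of positions, of distributions
in which only the positions in `T` carry a bias towards the needle. -/
theorem pow_mul_needlePMF (ht : 0 < t) (q : ℝ) (x : ℕ → Fin t) :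
    (t : ℝ) ^ n * needlePMF t n q (fun j => x j) =
      ∑ T ∈ (Finset.range n).powerset,
        ((∏ _i ∈ T, (2 * q)) * ∏ _i ∈ Finset.range n \ T, (1 - 2 * q)) *
          ∑ α, 1 / (t : ℝ) * ∏ l ∈ T, (1 + t * ind (fun a => a = α) (x l)) / 2 := by
  have ht' : (0 : ℝ) < t := by positivity
  simp only [needlePMF, Finset.mul_sum]
  rw [Finset.sum_comm]
  refine Finset.sum_congr rfl fun α _ => ?_
  have h1 := Finset.prod_add (fun l => 2 * q * ((1 + t * ind (fun a => a = α) (x l)) / 2))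
    (fun _ => 1 - 2 * q) (Finset.range n)
  have h2 : (t : ℝ) ^ n = ∏ _j : Fin n, (t : ℝ) := by simp
  have h3 : (t : ℝ) ^ n * ∏ j : Fin n, (if x j = α then q + (1 - q) / t else (1 - q) / t) =
      ∏ l ∈ Finset.range n,
        (2 * q * ((1 + t * ind (fun a => a = α) (x l)) / 2) + (1 - 2 * q)) := by
    rw [h2, ← Finset.prod_mul_distrib, ← Fin.prod_univ_eq_prod_range (fun l =>
      2 * q * ((1 + t * ind (fun a => a = α) (x l)) / 2) + (1 - 2 * q)) n]
    refine Finset.prod_congr rfl fun j _ => ?_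
    by_cases h : x j = α
    · simp only [h, ind, if_true]
      field_simp
      ring
    · simp only [h, ind, if_false]
      field_simp
      ring
  calc _ = 1 / (t : ℝ) * ((t : ℝ) ^ n *
        ∏ j : Fin n, (if x j = α then q + (1 - q) / t else (1 - q) / t)) := by ring
    _ = _ := by
      rw [h3, h1, Finset.mul_sum]
      refine Finset.sum_congr rfl fun T _ => ?_
      rw [Finset.prod_mul_distrib]
      ring

theorem Alg.le_sq_mul_MIC (M : Alg Ω p (Fin t) n k X) (hp : IsPMF p) (ht : 0 < t)
    (hX : ∀ x : Fin n → Fin t, pr p (fun ω => ∀ j : Fin n, X j.1 ω = x j) = (1 / (t : ℝ)) ^ n)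
    (hk : 1 ≤ k) (hfix : ∀ j ≤ n, ∀ ω, M.st (k - 1) j ω = M.passEnd (k - 1) ω)
    {q : ℝ} (hq0 : 0 < q) (hq : q ≤ 1 / 2)
    {g : M.S → ℝ} (hg0 : ∀ m, 0 ≤ g m) (hg1 : ∀ m, g m ≤ 1) :
    ∑ ω, p ω * g (M.passEnd k ω) + (1 - Real.exp 1) * ∑ ω, p ω *
        (g (M.passEnd k ω) * ((t : ℝ) ^ n * needlePMF t n q fun j => X j ω)) ≤
      (2 * q) ^ 2 * (Real.log 2 * M.MIC) := by
  let w (T : Finset ℕ) : ℝ := (∏ _i ∈ T, (2 * q)) * ∏ _i ∈ Finset.range n \ T, (1 - 2 * q)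
  have hw0 : ∀ T, 0 ≤ w T := fun T => mul_nonneg
    (Finset.prod_nonneg fun _ _ => by linarith) (Finset.prod_nonneg fun _ _ => by linarith)
  have hw1 : ∑ T ∈ (Finset.range n).powerset, w T = 1 := by
    rw [← Finset.prod_add]
    simp
  let B (T : Finset ℕ) : ℝ := ∑ α, 1 / (t : ℝ) * ∑ ω, p ω *
    (g (M.passEnd k ω) * ∏ l ∈ T, (1 + t * ind (fun ω => X l ω = α) ω) / 2)
  have hb : ∑ ω, p ω * (g (M.passEnd k ω) * ((t : ℝ) ^ n * needlePMF t n q fun j => X j ω)) =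
      ∑ T ∈ (Finset.range n).powerset, w T * B T := by
    have h1 := fun ω => pow_mul_needlePMF (n := n) ht q fun j => X j ω
    simp only [h1, B, Finset.mul_sum]
    rw [Finset.sum_comm]
    refine Finset.sum_congr rfl fun T _ => ?_
    rw [Finset.sum_comm]
    refine Finset.sum_congr rfl fun α _ => Finset.sum_congr rfl fun ω _ => ?_
    simp only [w, ind]
    ring
  let K (l e : ℕ) : ℝ := if l ≠ e then M.klCost l (if e = 0 then n else e) else 0
  have hT : ∀ T ∈ (Finset.range n).powerset,
      w T * (∑ ω, p ω * g (M.passEnd k ω) + (1 - Real.exp 1) * B T) ≤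
        w T * ∑ l ∈ T, ∑ e ∈ T, K l e := fun T hT =>
    mul_le_mul_of_nonneg_left
      (M.le_sum_klCost hp ht hX hk hfix (Finset.mem_powerset.1 hT) hg0 hg1) (hw0 T)
  have h2 : ∑ T ∈ (Finset.range n).powerset, w T * ∑ l ∈ T, ∑ e ∈ T, K l e =
      ∑ l ∈ Finset.range n, ∑ e ∈ Finset.range n, K l e * ∑ T ∈ (Finset.range n).powerset,
        if l ∈ T ∧ e ∈ T then w T else 0 := by
    have h3 : ∀ T ∈ (Finset.range n).powerset, w T * ∑ l ∈ T, ∑ e ∈ T, K l e =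
        ∑ l ∈ Finset.range n, ∑ e ∈ Finset.range n,
          K l e * if l ∈ T ∧ e ∈ T then w T else 0 := by
      intro T hT
      have hs : ∀ f : ℕ → ℝ, ∑ l ∈ T, f l = ∑ l ∈ Finset.range n, if l ∈ T then f l else 0 := by
        intro f
        rw [Finset.sum_ite_mem, Finset.inter_eq_right.2 (Finset.mem_powerset.1 hT)]
      rw [hs, Finset.mul_sum]
      refine Finset.sum_congr rfl fun l _ => ?_
      rw [hs]
      by_cases hl : l ∈ T
      · rw [if_pos hl, Finset.mul_sum]
        refine Finset.sum_congr rfl fun e _ => ?_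
        by_cases he : e ∈ T <;> simp [hl, he, mul_comm]
      · simp [hl]
    rw [Finset.sum_congr rfl h3, Finset.sum_comm]
    refine Finset.sum_congr rfl fun l _ => ?_
    rw [Finset.sum_comm]
    exact Finset.sum_congr rfl fun e _ => (Finset.mul_sum _ _ _).symm
  have h4 : ∑ l ∈ Finset.range n, ∑ e ∈ Finset.range n, K l e *
        (∑ T ∈ (Finset.range n).powerset, if l ∈ T ∧ e ∈ T then w T else 0) ≤
      (2 * q) ^ 2 * (Real.log 2 * M.MIC) := by
    rw [← M.sum_klCost_eq_MIC hp ht hX, Finset.mul_sum]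
    refine Finset.sum_le_sum fun l hl => ?_
    rw [Finset.mul_sum]
    refine Finset.sum_le_sum fun e he => ?_
    have hnn := mul_nonneg (sq_nonneg (2 * q)) (M.klCost_nonneg hp l (if e = 0 then n else e))
    by_cases hle : l = e
    · simpa [K, hle] using hle ▸ hnn
    · have := sum_powerset_mem_pair (θ := 2 * q) hl he hle
      rw [this]
      simp only [K, ne_eq, if_pos hle]
      rw [mul_comm]
  refine le_trans (le_of_eq ?_) ((Finset.sum_le_sum hT).trans (h2.le.trans h4))
  simp only [mul_add, Finset.sum_add_distrib, ← Finset.sum_mul, hw1, one_mul, hb]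
  rw [Finset.mul_sum]
  congr 1
  exact Finset.sum_congr rfl fun T _ => by ring

theorem pr_and_eq_sum {Y σ : Type} [Fintype σ] (hp : IsPMF p) {Out : Ω → Y} {b : Y} {Z : Ω → σ}
    (E : Ω → Prop)
    (h : ∀ m, pr p (fun ω => Out ω = b ∧ E ω ∧ Z ω = m) * pr p (fun ω => Z ω = m) =
      pr p (fun ω => Out ω = b ∧ Z ω = m) * pr p (fun ω => E ω ∧ Z ω = m)) :
    pr p (fun ω => Out ω = b ∧ E ω) =
      ∑ ω, p ω * (pr p (fun ω' => Out ω' = b ∧ Z ω' = Z ω) / pr p (fun ω' => Z ω' = Z ω) *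
        ind E ω) := by
  have h1 : pr p (fun ω => Out ω = b ∧ E ω) =
      ∑ ω, p ω * ind (fun ω => Out ω = b ∧ E ω) ω :=
    Finset.sum_congr rfl fun ω _ => by by_cases h : Out ω = b ∧ E ω <;> simp [ind, h]
  rw [h1, ← sum_exOn Z, ← sum_exOn Z]
  refine Finset.sum_congr rfl fun m _ => ?_
  rcases eq_or_ne (pr p (fun ω => Z ω = m)) 0 with h0 | h0
  · rw [exOn_eq_zero hp h0, exOn_eq_zero hp h0]
  · rw [exOn_ind]
    simp only [and_assoc]
    rw [← mul_left_inj' h0, h m]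
    have h2 : exOn p (fun ω => Z ω = m) (fun ω =>
        pr p (fun ω' => Out ω' = b ∧ Z ω' = Z ω) / pr p (fun ω' => Z ω' = Z ω) * ind E ω) =
        pr p (fun ω' => Out ω' = b ∧ Z ω' = m) / pr p (fun ω' => Z ω' = m) *
          exOn p (fun ω => Z ω = m) (ind E) := by
      simp only [exOn, Finset.mul_sum]
      refine Finset.sum_congr rfl fun ω _ => ?_
      by_cases hz : Z ω = m
      · simp only [hz, if_true]; ring
      · simp [hz]
    rw [h2, exOn_ind]
    field_simp

end Uniform

/-- Lemma `thm:lowerbound`: there is an absolute constant `c > 0`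
such that for all `t, n` with `n ≤ t/100` and all needle probabilities `q ∈ (0,1/2]`,
any `k`-pass streaming algorithm on streams in `[t]^n` whose memory does not change
during its `k`-th pass — with an output bit that is a (possibly randomized) function of
the final memory state — that distinguishes `D0` from `D1` with
`Pr[out = 1 | D0] + Pr[out = 0 | D1] ≤ 0.01` must satisfy `MIC(M, D0) ≥ c/q²`. -/
theorem needle_problem_mic_lower_bound :
    ∃ c : ℝ, 0 < c ∧
      ∀ (t n : ℕ), 1 ≤ n → 100 * n ≤ t →
        ∀ q : ℝ, 0 < q → q ≤ 1 / 2 →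
          ∀ (k : ℕ), 1 ≤ k →
          ∀ (Ω : Type) [Fintype Ω], ∀ (p : Ω → ℝ) (X : ℕ → Ω → Fin t)
            (M : Alg Ω p (Fin t) n k X) (Out : Ω → Bool),
            IsPMF p →
            -- the input is distributed according to `D0` (i.i.d. uniform on `[t]`):
            (∀ x : Fin n → Fin t,
              pr p (fun ω => ∀ j : Fin n, X j.1 ω = x j) = (1 / (t : ℝ)) ^ n) →
            -- the memory does not change during the `k`-th pass:
            (∀ j ≤ n, ∀ ω, M.st (k - 1) j ω = M.passEnd (k - 1) ω) →
            -- `Out` is conditionally independent of the input given the final state: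
            (∀ (b : Bool) (x : Fin n → Fin t) (m : M.S),
              pr p (fun ω => Out ω = b ∧ (∀ j : Fin n, X j.1 ω = x j) ∧
                    M.passEnd k ω = m) *
                  pr p (fun ω => M.passEnd k ω = m)
                = pr p (fun ω => Out ω = b ∧ M.passEnd k ω = m) *
                  pr p (fun ω => (∀ j : Fin n, X j.1 ω = x j) ∧ M.passEnd k ω = m)) →
            -- the total error for distinguishing `D0` from `D1` is at most `0.01`:
            pr p (fun ω => Out ω = true)
                + (∑ x : Fin n → Fin t, needlePMF t n q x *
                    (pr p (fun ω => Out ω = false ∧ ∀ j : Fin n, X j.1 ω = x j) /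
                      pr p (fun ω => ∀ j : Fin n, X j.1 ω = x j)))
              ≤ 0.01 →
            c / q ^ 2 ≤ M.MIC := by
  refine ⟨1 / 8, by norm_num, ?_⟩
  intro t n hn htn q hq0 hq k hk Ω _ p X M Out hp hX hfix hOut herr
  have ht : 0 < t := by omega
  have ht' : (0 : ℝ) < t := by positivity
  let g (m : M.S) : ℝ :=
    pr p (fun ω => Out ω = false ∧ M.passEnd k ω = m) / pr p (fun ω => M.passEnd k ω = m)
  have hg0 : ∀ m, 0 ≤ g m := fun m => div_nonneg (pr_nonneg hp _) (pr_nonneg hp _)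
  have hg1 : ∀ m, g m ≤ 1 := fun m => div_le_one_of_le₀
    (Finset.sum_le_sum fun ω _ => by
      by_cases h1 : Out ω = false <;> by_cases h2 : M.passEnd k ω = m <;>
        simp [h1, h2, hp.nonneg ω]) (pr_nonneg hp _)
  have key := M.le_sq_mul_MIC hp ht hX hk hfix hq0 hq hg0 hg1
  have ha : pr p (fun ω => Out ω = true) = 1 - ∑ ω, p ω * g (M.passEnd k ω) := by
    have h1 := pr_and_eq_sum hp (Out := Out) (b := false) (Z := M.passEnd k) (fun _ => True)
      fun m => by simp
    simp only [and_true, ind, if_true, mul_one] at h1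
    rw [← h1, ← hp.sum_one, eq_sub_iff_add_eq, pr, pr, ← Finset.sum_add_distrib]
    exact Finset.sum_congr rfl fun ω _ => by cases h : Out ω <;> simp
  have hb : ∑ x : Fin n → Fin t, needlePMF t n q x *
      (pr p (fun ω => Out ω = false ∧ ∀ j : Fin n, X j.1 ω = x j) /
        pr p (fun ω => ∀ j : Fin n, X j.1 ω = x j)) =
      ∑ ω, p ω * (g (M.passEnd k ω) * ((t : ℝ) ^ n * needlePMF t n q fun j => X j ω)) := by
    have h1 : ∀ x : Fin n → Fin t, needlePMF t n q x *
        (pr p (fun ω => Out ω = false ∧ ∀ j : Fin n, X j.1 ω = x j) /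
          pr p (fun ω => ∀ j : Fin n, X j.1 ω = x j)) =
        ∑ ω, p ω * (g (M.passEnd k ω) * ind (fun ω => ∀ j : Fin n, X j.1 ω = x j) ω) *
          ((t : ℝ) ^ n * needlePMF t n q x) := by
      intro x
      rw [pr_and_eq_sum hp (fun ω => ∀ j : Fin n, X j.1 ω = x j) (hOut false x), hX x,
        ← Finset.sum_mul]
      simp only [one_div, inv_pow, div_inv_eq_mul, g]
      ring
    rw [Finset.sum_congr rfl fun x _ => h1 x, Finset.sum_comm]
    refine Finset.sum_congr rfl fun ω _ => ?_
    rw [Finset.sum_eq_single fun j => X j.1 ω]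
    · simp only [ind, implies_true, if_true]
      ring
    · intro x _ hx
      have : ¬ ∀ j : Fin n, X j.1 ω = x j := fun h => hx (funext fun j => (h j).symm)
      simp [ind, this]
    · simp
  rw [ha, hb] at herr
  have hb0 : 0 ≤ ∑ ω, p ω *
      (g (M.passEnd k ω) * ((t : ℝ) ^ n * needlePMF t n q fun j => X j ω)) := by
    have hq1 : 0 ≤ (1 - q) / (t : ℝ) := div_nonneg (by linarith) ht'.le
    refine Finset.sum_nonneg fun ω _ => mul_nonneg (hp.nonneg ω) (mul_nonneg (hg0 _)
      (mul_nonneg (by positivity) (Finset.sum_nonneg fun α _ => mul_nonneg (by positivity)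
        (Finset.prod_nonneg fun j _ => ?_))))
    split_ifs <;> linarith
  have ha0 : 0 ≤ pr p fun ω => Out ω = true := pr_nonneg hp _
  rw [ha] at ha0
  have hMIC : 0 ≤ Real.log 2 * M.MIC := by
    rw [← M.sum_klCost_eq_MIC hp ht hX]
    exact Finset.sum_nonneg fun l _ => Finset.sum_nonneg fun e _ => M.klCost_nonneg hp l _
  have hlog0 := Real.log_pos one_lt_two
  have hlog1 := Real.log_two_lt_d9
  have hM0 : 0 ≤ M.MIC := nonneg_of_mul_nonneg_right hMIC hlog0
  have hlogM : Real.log 2 * M.MIC ≤ M.MIC := by nlinarith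
  rw [div_le_iff₀ (by positivity)]
  have hexp := Real.exp_one_lt_d9
  have h5 := mul_le_mul_of_nonneg_left hlogM (sq_nonneg (2 * q))
  nlinarith

end MultiPassIC
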